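/- arXiv:2007.14623 — 2 statements merged into one kernel-verified Lean document; each statement's English description precedes it below -/
import Mathlib

section
/- Let G be a K_4-free graph on n vertices with exactly cn² edges, c < 1/2, and with n/2 ≤ δ(G) ≤ Δ(G) ≤ 9n/14. Suppose every vertex set of size ⌊n/2⌋ in G spans at least n²/18 edges. Then there exist three pairwise disjoint independent sets V₁, V₂, V₃ in G such that |V₁| + |V₂| + |V₃| ≥ n/(3(1 − 2c)). -/
open Finset

/-- Number of edges of `G` with both endpoints in `S`. -/
def edgesIn {V : Type*} [Fintype V] [DecidableEq V] (G : SimpleGraph V) [DecidableRel G.Adj]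
    (S : Finset V) : ℕ :=
  (G.edgeFinset.filter fun e => ∀ v ∈ e, v ∈ S).card

/-- Number of edges of `G` with one endpoint in `A` and the other in `B`. -/
def edgesBetween {V : Type*} [Fintype V] [DecidableEq V] (G : SimpleGraph V) [DecidableRel G.Adj]
    (A B : Finset V) : ℕ :=
  (G.edgeFinset.filter fun e => ∃ a ∈ A, ∃ b ∈ B, e = s(a, b)).card

/-- A lower bound for the coefficient of a squared degree deviation. -/
lemma deviation_coeff_lower_bound {r s : ℝ} (hr : 5 / 14 ≤ r) (hr' : r ≤ 1 / 2)
    (hs : 5 / 14 ≤ s) :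
    14 / 45 + (14 / 9) * (1 / 9 + s) ≤ 1 / (9 * r) + (1 / 9 + s) / (1 - r) := by
  have hr0 : 0 < r := by linarith
  have hr1 : 0 < 1 - r := by linarith
  have key : 1 / (9 * r) + (1 / 9 + s) / (1 - r) - (14 / 45 + (14 / 9) * (1 / 9 + s))
      = (r - 5 / 14) * ((14 / 9) * (1 / 9 + s) / (1 - r) - 14 / (45 * r)) := by
    field_simp
    ring
  have h : 14 / (45 * r) ≤ (14 / 9) * (1 / 9 + s) / (1 - r) := by
    rw [div_le_div_iff₀ (by positivity) hr1]
    nlinarith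
  nlinarith [mul_nonneg (sub_nonneg.2 hr) (sub_nonneg.2 h)]

/-- The inequality between the (normalised) degrees `1 - r`, `1 - q` of the two ends of an edge
and the average degree `1 - s`. -/
lemma edge_inequality {r q s : ℝ} (hr : 5 / 14 ≤ r) (hr' : r ≤ 1 / 2)
    (hq : 5 / 14 ≤ q) (hq' : q ≤ 1 / 2) (hs : 5 / 14 ≤ s) (hs' : s ≤ 1 / 2) :
    2 / (9 * s) ≤
      (1 / 9 + (s - q) - ((s - r) + (s - q)) ^ 2 / 2) / r
        + (1 / 9 + (s - r) - ((s - q) + (s - r)) ^ 2 / 2) / q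
        + (1 / (9 * s ^ 2) + 1 / s) * ((s - r) ^ 2 / (1 - r) - (s - r))
        + (1 / (9 * s ^ 2) + 1 / s) * ((s - q) ^ 2 / (1 - q) - (s - q)) := by
  have hr0 : 0 < r := by linarith
  have hq0 : 0 < q := by linarith
  have hs0 : 0 < s := by linarith
  have hr1 : 0 < 1 - r := by linarith
  have hq1 : 0 < 1 - q := by linarith
  obtain ⟨x, hx⟩ : ∃ x, x = s - r := ⟨_, rfl⟩
  obtain ⟨y, hy⟩ : ∃ y, y = s - q := ⟨_, rfl⟩
  rw [← hx, ← hy]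
  set α := 1 / (9 * r) + (1 / 9 + s) / (1 - r) with hα
  set β := 1 / (9 * q) + (1 / 9 + s) / (1 - q) with hβ
  have key : (1 / 9 + y - (x + y) ^ 2 / 2) / r + (1 / 9 + x - (y + x) ^ 2 / 2) / q
        + (1 / (9 * s ^ 2) + 1 / s) * (x ^ 2 / (1 - r) - x)
        + (1 / (9 * s ^ 2) + 1 / s) * (y ^ 2 / (1 - q) - y) - 2 / (9 * s)
      = (α * x ^ 2 + β * y ^ 2
          + (1 / r + 1 / q) * (s * (1 - s) * (x * y) - s ^ 2 / 2 * (x ^ 2 + y ^ 2))) / s ^ 2 := by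
    rw [hα, hβ, hx, hy]
    field_simp
    ring
  have ha := deviation_coeff_lower_bound hr hr' hs
  have hb := deviation_coeff_lower_bound hq hq' hs
  rw [← hα] at ha
  rw [← hβ] at hb
  have hri : 1 / r ≤ 14 / 5 := by rw [div_le_div_iff₀ hr0 (by norm_num)]; linarith
  have hqi : 1 / q ≤ 14 / 5 := by rw [div_le_div_iff₀ hq0 (by norm_num)]; linarith
  have hri0 : 0 < 1 / r := by positivity
  have hqi0 : 0 < 1 / q := by positivity
  set a₀ := 14 / 45 + (14 / 9) * (1 / 9 + s) with ha₀
  have hquad : a₀ * (x ^ 2 + y ^ 2) ≤ α * x ^ 2 + β * y ^ 2 := by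
    linarith only [mul_le_mul_of_nonneg_right ha (sq_nonneg x),
      mul_le_mul_of_nonneg_right hb (sq_nonneg y)]
  have hZ : 0 ≤ x ^ 2 + y ^ 2 := by positivity
  have hnum : 0 ≤ α * x ^ 2 + β * y ^ 2
      + (1 / r + 1 / q) * (s * (1 - s) * (x * y) - s ^ 2 / 2 * (x ^ 2 + y ^ 2)) := by
    rcases le_total 0 (x * y) with hxy | hxy
    · have h1 : -(s ^ 2 / 2 * (x ^ 2 + y ^ 2))
          ≤ s * (1 - s) * (x * y) - s ^ 2 / 2 * (x ^ 2 + y ^ 2) := by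
        have : 0 ≤ s * (1 - s) * (x * y) := by
          have : 0 ≤ 1 - s := by linarith
          positivity
        linarith
      have h2 : (1 / r + 1 / q) * (s ^ 2 / 2 * (x ^ 2 + y ^ 2))
          ≤ (28 / 5) * (s ^ 2 / 2 * (x ^ 2 + y ^ 2)) :=
        mul_le_mul_of_nonneg_right (by linarith) (by positivity)
      have h3 := mul_le_mul_of_nonneg_left h1 (add_pos hri0 hqi0).le
      have h4 : 28 / 5 * (s ^ 2 / 2) ≤ a₀ := by nlinarith only [hs, hs', ha₀]
      have h5 := mul_le_mul_of_nonneg_right h4 hZ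
      linarith only [h2, h3, h5, hquad]
    · have hsum : 1 / r + 1 / q ≤ 14 / 5 + 1 / s := by
        rcases le_or_gt s r with h | h
        · have := one_div_le_one_div_of_le hs0 h
          linarith
        · have hsq : s ≤ q := by
            by_contra! hlt
            exact hxy.not_gt (mul_pos (by linarith) (by linarith))
          have := one_div_le_one_div_of_le hs0 hsq
          linarith
      have h1 : -(s / 2 * (x ^ 2 + y ^ 2))
          ≤ s * (1 - s) * (x * y) - s ^ 2 / 2 * (x ^ 2 + y ^ 2) := by
        have : 0 ≤ s * (1 - s) := mul_nonneg hs0.le (by linarith)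
        linarith only [mul_nonneg this (sq_nonneg (x + y))]
      have h2 : (1 / r + 1 / q) * (s / 2 * (x ^ 2 + y ^ 2))
          ≤ (14 / 5 + 1 / s) * (s / 2 * (x ^ 2 + y ^ 2)) :=
        mul_le_mul_of_nonneg_right hsum (by positivity)
      have h3 := mul_le_mul_of_nonneg_left h1 (add_pos hri0 hqi0).le
      have h4 : (14 / 5 + 1 / s) * (s / 2 * (x ^ 2 + y ^ 2))
          = (7 / 5 * s + 1 / 2) * (x ^ 2 + y ^ 2) := by
        field_simp
        ring
      have h5 : 7 / 5 * s + 1 / 2 ≤ a₀ := by linarith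
      have h6 := mul_le_mul_of_nonneg_right h5 hZ
      linarith only [h2, h3, h4, h6, hquad]
  have := div_nonneg hnum (sq_nonneg s)
  linarith

/-- Some `k`-subset of a finite set has at most average weight. -/
lemma exists_subset_card_eq_sum_le {ι : Type*} [DecidableEq ι] (f : ι → ℝ) (k : ℕ)
    (I : Finset ι) (hk : k ≤ I.card) :
    ∃ K ⊆ I, K.card = k ∧ (I.card : ℝ) * ∑ i ∈ K, f i ≤ k * ∑ i ∈ I, f i := by
  induction hm : I.card - k generalizing I with
  | zero => exact ⟨I, subset_rfl, by omega, by rw [show I.card = k by omega]⟩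
  | succ m ih =>
    have hne : I.Nonempty := by
      rw [← card_pos]
      omega
    obtain ⟨j, hj, hmax⟩ := I.exists_max_image f hne
    have hcard := card_erase_add_one hj
    obtain ⟨K, hKI, hKk, hK⟩ := ih (I.erase j) (by omega) (by omega)
    refine ⟨K, hKI.trans (erase_subset _ _), hKk, ?_⟩
    have hsum := add_sum_erase I f hj
    have hKle : ∑ i ∈ K, f i ≤ k * f j := by
      rw [← hKk, ← nsmul_eq_mul]
      exact sum_le_card_nsmul _ _ _ fun i hi => hmax i (erase_subset _ _ (hKI hi))
    have hcard' : (I.card : ℝ) = ((I.erase j).card : ℝ) + 1 := by exact_mod_cast hcard.symm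
    rw [hcard', ← hsum]
    linarith

/-- The deduction of a lower bound for a sum of codegrees `t` from the sparse half
inequalities at a single vertex with neighbourhood `A`. -/
lemma sum_codegree_lower_bound {ι : Type*} (A : Finset ι) (f t : ι → ℝ) {N e κ : ℝ} (c : ℝ)
    (hA : A.Nonempty) (hcard : (A.card : ℝ) = κ + N / 2) (hκ : 0 ≤ κ) (ht : ∀ w ∈ A, κ ≤ t w)
    (h : (∑ w ∈ A, t w) * (N ^ 2 / 18 - (e - ∑ w ∈ A, f w + (∑ w ∈ A, t w) / 2))
      ≤ κ * ∑ w ∈ A, t w * (f w - t w))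
    (h₀ : ∑ w ∈ A, t w = 0 → N ^ 2 / 18 ≤ e - ∑ w ∈ A, f w) :
    ∑ w ∈ A, (N ^ 2 / 9 - 2 * e + N * f w - (f w - c) ^ 2 / 2)
      ≤ (∑ w ∈ A, t w) * (N - A.card) := by
  set a : ℝ := (A.card : ℝ) with ha
  have ha0 : 0 < a := Nat.cast_pos.2 hA.card_pos
  set F := ∑ w ∈ A, f w with hF
  set T := ∑ w ∈ A, t w with hT
  set W := ∑ w ∈ A, (f w - c) ^ 2 with hW
  have hW0 : 0 ≤ W := sum_nonneg fun _ _ => sq_nonneg _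
  have hlhs : ∑ w ∈ A, (N ^ 2 / 9 - 2 * e + N * f w - (f w - c) ^ 2 / 2)
      = a * (N ^ 2 / 9 - 2 * e) + N * F - W / 2 := by
    rw [sum_sub_distrib, sum_add_distrib, sum_const, nsmul_eq_mul, ← mul_sum, ← sum_div]
  have hTκ : a * κ ≤ T := by
    have := card_nsmul_le_sum A t κ ht
    rwa [nsmul_eq_mul] at this
  have hWexp : W = ∑ w ∈ A, f w ^ 2 - 2 * c * F + a * c ^ 2 := by
    have : ∀ w ∈ A, (f w - c) ^ 2 = f w ^ 2 - 2 * c * f w + c ^ 2 := fun w _ => by ring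
    rw [hW, sum_congr rfl this, sum_add_distrib, sum_sub_distrib, sum_const, nsmul_eq_mul,
      ← mul_sum]
  have hsq : 0 ≤ ∑ w ∈ A, ((t w - T / a) - (f w - F / a) / 2) ^ 2 :=
    sum_nonneg fun _ _ => sq_nonneg _
  have hsqexp : ∑ w ∈ A, ((t w - T / a) - (f w - F / a) / 2) ^ 2
      = -∑ w ∈ A, t w * (f w - t w) + (∑ w ∈ A, f w ^ 2) / 4
        - (2 * T / a - F / a) * T + (T / a - F / (2 * a)) * F
        + a * (T / a - F / (2 * a)) ^ 2 := by
    have : ∀ w ∈ A, ((t w - T / a) - (f w - F / a) / 2) ^ 2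
        = -(t w * (f w - t w)) + f w ^ 2 / 4 - (2 * T / a - F / a) * t w
          + (T / a - F / (2 * a)) * f w + (T / a - F / (2 * a)) ^ 2 := fun w _ => by
      field_simp
      ring
    rw [sum_congr rfl this]
    simp only [sum_add_distrib, sum_sub_distrib, sum_const, nsmul_eq_mul, ← mul_sum, ← sum_div,
      sum_neg_distrib]
    rw [← hT, ← hF, ← ha]
  have hcov : a * ∑ w ∈ A, t w * (f w - t w) ≤ T * F - T ^ 2 + a * W / 4 := by
    have h1 : 0 ≤ a * (-∑ w ∈ A, t w * (f w - t w) + (∑ w ∈ A, f w ^ 2) / 4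
        - (2 * T / a - F / a) * T + (T / a - F / (2 * a)) * F
        + a * (T / a - F / (2 * a)) ^ 2) := by
      rw [← hsqexp]
      exact mul_nonneg ha0.le hsq
    have h2 : a * (-∑ w ∈ A, t w * (f w - t w) + (∑ w ∈ A, f w ^ 2) / 4
        - (2 * T / a - F / a) * T + (T / a - F / (2 * a)) * F
        + a * (T / a - F / (2 * a)) ^ 2)
        = -(a * ∑ w ∈ A, t w * (f w - t w)) + a * (∑ w ∈ A, f w ^ 2) / 4
          - T ^ 2 + T * F - F ^ 2 / 4 := by
      field_simp
      ring
    rw [h2] at h1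
    nlinarith [sq_nonneg (F - a * c)]
  rw [hlhs]
  have hT0 : 0 ≤ T := le_trans (by positivity) hTκ
  rcases hT0.eq_or_lt with hT0 | hT0
  · have hκ0 : κ = 0 := by nlinarith
    have h1 := h₀ hT0.symm
    have hN : N = 2 * a := by linarith
    rw [← hT0]
    have := mul_le_mul_of_nonneg_left h1 ha0.le
    rw [hN] at this ⊢
    nlinarith
  · have hN : N = 2 * (a - κ) := by linarith
    have h1 : T * (a * (N ^ 2 / 18 - (e - F + T / 2))) ≤ T * (κ * (F - T) + W / 4) := by
      have h2 := mul_le_mul_of_nonneg_left h ha0.le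
      have h3 := mul_le_mul_of_nonneg_left hcov hκ
      have h4 := mul_le_mul_of_nonneg_right hTκ hW0
      nlinarith
    have h2 := le_of_mul_le_mul_left h1 hT0
    have hTN : T * (N - a) = T * a - 2 * (T * κ) := by rw [hN]; ring
    have hFN : N * F = 2 * (a * F) - 2 * (κ * F) := by rw [hN]; ring
    linarith

section Graph

variable {V : Type*} (G : SimpleGraph V)

/-- In a `K₄`-free graph common neighbourhoods of adjacent vertices are independent. -/
lemma not_adj_of_mem_common_neighbors (hK4 : G.CliqueFree 4) {u v a b : V} (huv : G.Adj u v)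
    (hua : G.Adj u a) (hva : G.Adj v a) (hub : G.Adj u b) (hvb : G.Adj v b) : ¬ G.Adj a b := by
  classical
  intro hab
  refine hK4 {u, v, a, b} ?_
  rw [SimpleGraph.isNClique_iff]
  refine ⟨?_, ?_⟩
  · simp [SimpleGraph.isClique_iff, Set.pairwise_insert, huv, hua, hva, hub, hvb, hab, huv.symm,
      hua.symm, hva.symm, hub.symm, hvb.symm, hab.symm]
  · simp [huv.ne, hua.ne, hva.ne, hub.ne, hvb.ne, hab.ne]

variable [DecidableRel G.Adj]

/-- The indicator of adjacency, as a real number. -/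
noncomputable def adjIndicator (x y : V) : ℝ :=
  if G.Adj x y then 1 else 0

lemma adjIndicator_comm (x y : V) : adjIndicator G x y = adjIndicator G y x := by
  simp [adjIndicator, G.adj_comm]

lemma adjIndicator_nonneg (x y : V) : 0 ≤ adjIndicator G x y := by
  unfold adjIndicator
  positivity

variable [Fintype V]

lemma degree_eq_sum_adjIndicator (v : V) : (G.degree v : ℝ) = ∑ w, adjIndicator G v w := by
  rw [← SimpleGraph.card_neighborFinset_eq_degree, SimpleGraph.neighborFinset_eq_filter]
  simp [adjIndicator]

lemma sum_neighborFinset_eq (v : V) (f : V → ℝ) :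
    ∑ w ∈ G.neighborFinset v, f w = ∑ w, adjIndicator G v w * f w := by
  rw [SimpleGraph.neighborFinset_eq_filter, sum_filter]
  simp [adjIndicator]

/-- Some triangle has at least the average sum of codegrees. -/
lemma exists_triangle_sum_codegree_ge (t : V → V → ℝ)
    (ht : ∀ u v, t u v = ∑ w, adjIndicator G u w * adjIndicator G v w)
    (hpos : 0 < ∑ u, ∑ v, adjIndicator G u v * t u v) :
    ∃ u v w, G.Adj u v ∧ G.Adj u w ∧ G.Adj v w ∧
      3 * (∑ u, ∑ v, adjIndicator G u v * t u v ^ 2)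
        ≤ (∑ u, ∑ v, adjIndicator G u v * t u v) * (t u v + t u w + t v w) := by
  by_contra! hlt
  set T₁ := ∑ u, ∑ v, adjIndicator G u v * t u v with hT₁
  set T₂ := ∑ u, ∑ v, adjIndicator G u v * t u v ^ 2 with hT₂
  set p : V → V → V → ℝ := fun u v w =>
    adjIndicator G u v * (adjIndicator G u w * adjIndicator G v w) with hp
  have hp0 : ∀ u v w, 0 ≤ p u v w := fun u v w =>
    mul_nonneg (adjIndicator_nonneg G _ _)
      (mul_nonneg (adjIndicator_nonneg G _ _) (adjIndicator_nonneg G _ _))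
  have hT₁p : ∑ u, ∑ v, ∑ w, p u v w = T₁ := by
    simp only [hp, ← mul_sum, ← ht, hT₁]
  have h12 : ∑ u, ∑ v, ∑ w, p u v w * t u v = T₂ := by
    simp only [hp, ← mul_sum, ← sum_mul, ← ht, hT₂]
    exact sum_congr rfl fun u _ => sum_congr rfl fun v _ => by ring
  have h13 : ∑ u, ∑ v, ∑ w, p u v w * t u w = T₂ := by
    rw [← h12]
    refine sum_congr rfl fun u _ => ?_
    rw [sum_comm]
    refine sum_congr rfl fun v _ => sum_congr rfl fun w _ => ?_
    simp only [hp]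
    rw [adjIndicator_comm G w v]
    ring
  have h23 : ∑ u, ∑ v, ∑ w, p u v w * t v w = T₂ := by
    rw [← h13, sum_comm]
    refine sum_congr rfl fun u _ => sum_congr rfl fun v _ => sum_congr rfl fun w _ => ?_
    simp only [hp]
    rw [adjIndicator_comm G v u]
    ring
  have hterm : ∀ u v w, 0 ≤ p u v w * (3 * T₂ - T₁ * (t u v + t u w + t v w)) := by
    intro u v w
    by_cases h : G.Adj u v ∧ G.Adj u w ∧ G.Adj v w
    · exact mul_nonneg (hp0 u v w) (sub_nonneg.2 (hlt u v w h.1 h.2.1 h.2.2).le)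
    · have : p u v w = 0 := by
        simp only [hp, adjIndicator]
        by_contra hne
        simp at hne
        tauto
      rw [this, zero_mul]
  have hzero : ∑ u, ∑ v, ∑ w, p u v w * (3 * T₂ - T₁ * (t u v + t u w + t v w)) = 0 := by
    have : ∀ u v w, p u v w * (3 * T₂ - T₁ * (t u v + t u w + t v w))
        = 3 * T₂ * p u v w
          - T₁ * (p u v w * t u v + p u v w * t u w + p u v w * t v w) := fun u v w => by ring
    simp only [this, sum_sub_distrib, sum_add_distrib, ← mul_sum]
    rw [hT₁p, h12, h13, h23]
    ring
  obtain ⟨u, -, hu⟩ := exists_lt_of_sum_lt (s := univ) (f := fun _ : V => (0 : ℝ))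
    (g := fun u => ∑ v, ∑ w, p u v w) (by rw [hT₁p]; simpa using hpos)
  obtain ⟨v, -, hv⟩ := exists_lt_of_sum_lt (s := univ) (f := fun _ : V => (0 : ℝ))
    (g := fun v => ∑ w, p u v w) (by simpa using hu)
  obtain ⟨w, -, hw⟩ := exists_lt_of_sum_lt (s := univ) (f := fun _ : V => (0 : ℝ))
    (g := fun w => p u v w) (by simpa using hv)
  rw [sum_eq_zero_iff_of_nonneg fun u _ => sum_nonneg fun v _ => sum_nonneg fun w _ =>
    hterm u v w] at hzero
  have hzero := hzero u (mem_univ u)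
  rw [sum_eq_zero_iff_of_nonneg fun v _ => sum_nonneg fun w _ => hterm u v w] at hzero
  have hzero := hzero v (mem_univ v)
  rw [sum_eq_zero_iff_of_nonneg fun w _ => hterm u v w] at hzero
  have hzero := hzero w (mem_univ w)
  have hadj : G.Adj u v ∧ G.Adj u w ∧ G.Adj v w := by
    have hne := hw.ne'
    simp only [hp, adjIndicator] at hne
    simp at hne
    tauto
  have := hlt u v w hadj.1 hadj.2.1 hadj.2.2
  exact (mul_pos hw (sub_pos.2 this)).ne' hzero

variable [DecidableEq V]

lemma two_mul_edgesIn (S : Finset V) :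
    2 * (edgesIn G S : ℝ) = ∑ x ∈ S, ∑ y ∈ S, adjIndicator G x y := by
  let H : SimpleGraph V :=
    { Adj := fun a b => G.Adj a b ∧ a ∈ S ∧ b ∈ S
      symm := ⟨fun _ _ h => ⟨h.1.symm, h.2.2, h.2.1⟩⟩
      loopless := ⟨fun _ h => G.irrefl h.1⟩ }
  have : DecidableRel H.Adj := fun a b => inferInstanceAs (Decidable (G.Adj a b ∧ a ∈ S ∧ b ∈ S))
  have hE : H.edgeFinset = G.edgeFinset.filter fun e => ∀ v ∈ e, v ∈ S := by
    ext e
    induction e with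
    | _ a b => simp [H]
  have h := H.sum_degrees_eq_twice_card_edges
  rw [hE] at h
  have h' : 2 * (edgesIn G S : ℝ) = ∑ v, (H.degree v : ℝ) := by
    rw [edgesIn]
    exact_mod_cast h.symm
  rw [h', ← sum_subset (subset_univ S)]
  · refine sum_congr rfl fun x hx => ?_
    rw [← SimpleGraph.card_neighborFinset_eq_degree, SimpleGraph.neighborFinset_eq_filter]
    simp only [adjIndicator, sum_boole]
    congr 2
    ext y
    simp [H, hx, and_comm]
  · intro x _ hx
    rw [← SimpleGraph.card_neighborFinset_eq_degree, SimpleGraph.neighborFinset_eq_filter]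
    simp [H, hx]

lemma card_inter_neighborFinset (A : Finset V) (w : V) :
    ((A ∩ G.neighborFinset w).card : ℝ) = ∑ y ∈ A, adjIndicator G w y := by
  simp only [adjIndicator, sum_boole]
  congr 2
  ext y
  simp

/-- The number of edges spanned by an independent subset `K` of `A` and the complement of `A`. -/
lemma edgesIn_compl_union (A K : Finset V) (hKA : K ⊆ A)
    (hK : ∀ a ∈ K, ∀ b ∈ K, ¬ G.Adj a b) :
    (edgesIn G (Aᶜ ∪ K) : ℝ) = G.edgeFinset.card - ∑ w ∈ A, (G.degree w : ℝ)
      + (∑ w ∈ A, ((A ∩ G.neighborFinset w).card : ℝ)) / 2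
      + ∑ w ∈ K, ((G.degree w : ℝ) - (A ∩ G.neighborFinset w).card) := by
  have hdisj : Disjoint Aᶜ K := disjoint_compl_left.mono_right hKA
  have hE : 2 * (G.edgeFinset.card : ℝ) = ∑ v, (G.degree v : ℝ) := by
    exact_mod_cast G.sum_degrees_eq_twice_card_edges.symm
  have hrow : ∀ x, ∑ y ∈ Aᶜ, adjIndicator G x y
      = (G.degree x : ℝ) - (A ∩ G.neighborFinset x).card := fun x => by
    rw [degree_eq_sum_adjIndicator, card_inter_neighborFinset, ← sum_add_sum_compl A]
    ring
  have hKK : ∑ x ∈ K, ∑ y ∈ K, adjIndicator G x y = 0 :=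
    sum_eq_zero fun x hx => sum_eq_zero fun y hy => by
      simp [adjIndicator, hK x hx y hy]
  have hBK : ∑ x ∈ Aᶜ, ∑ y ∈ K, adjIndicator G x y = ∑ x ∈ K, ∑ y ∈ Aᶜ, adjIndicator G x y := by
    rw [sum_comm]
    exact sum_congr rfl fun x _ => sum_congr rfl fun y _ => adjIndicator_comm G y x
  have hAB : ∑ x ∈ Aᶜ, ∑ y ∈ A, adjIndicator G x y = ∑ x ∈ A, ∑ y ∈ Aᶜ, adjIndicator G x y := by
    rw [sum_comm]
    exact sum_congr rfl fun x _ => sum_congr rfl fun y _ => adjIndicator_comm G y x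
  have hBB : ∑ x ∈ Aᶜ, ∑ y ∈ Aᶜ, adjIndicator G x y
      = 2 * (G.edgeFinset.card : ℝ) - 2 * ∑ w ∈ A, (G.degree w : ℝ)
        + ∑ w ∈ A, ((A ∩ G.neighborFinset w).card : ℝ) := by
    have h1 : ∑ x ∈ Aᶜ, (G.degree x : ℝ)
        = ∑ x ∈ Aᶜ, ∑ y ∈ A, adjIndicator G x y + ∑ x ∈ Aᶜ, ∑ y ∈ Aᶜ, adjIndicator G x y := by
      rw [← sum_add_distrib]
      exact sum_congr rfl fun x _ => by rw [degree_eq_sum_adjIndicator, sum_add_sum_compl]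
    rw [hAB] at h1
    simp only [hrow, sum_sub_distrib] at h1 ⊢
    rw [hE, ← sum_add_sum_compl A]
    linarith
  have h := two_mul_edgesIn G (Aᶜ ∪ K)
  simp only [sum_union hdisj, sum_add_distrib] at h
  rw [hKK, hBK, hBB] at h
  simp only [hrow] at h
  linarith

lemma degree_add_degree_le (v w : V) :
    G.degree v + G.degree w
      ≤ Fintype.card V + (G.neighborFinset v ∩ G.neighborFinset w).card := by
  rw [← SimpleGraph.card_neighborFinset_eq_degree, ← SimpleGraph.card_neighborFinset_eq_degree,
    ← card_union_add_card_inter]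
  exact Nat.add_le_add_right (card_le_univ _) _

lemma sum_codegree_ge (hK4 : G.CliqueFree 4) (N : ℝ) (hN : N = Fintype.card V) (hN0 : 0 < N)
    (hdeg : ∀ v, N / 2 ≤ (G.degree v : ℝ))
    (hsparse : ∀ S : Finset V, S.card = Fintype.card V / 2 → N ^ 2 / 18 ≤ (edgesIn G S : ℝ))
    (v : V) (c : ℝ) :
    ∑ w ∈ G.neighborFinset v, (N ^ 2 / 9 - 2 * (G.edgeFinset.card : ℝ)
        + N * (G.degree w : ℝ) - ((G.degree w : ℝ) - c) ^ 2 / 2)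
      ≤ (∑ w ∈ G.neighborFinset v, ((G.neighborFinset v ∩ G.neighborFinset w).card : ℝ))
        * (N - G.degree v) := by
  set A := G.neighborFinset v with hA
  have hAd : A.card = G.degree v := G.card_neighborFinset_eq_degree v
  have hAd' : (A.card : ℝ) = G.degree v := by exact_mod_cast hAd
  have hnd : Fintype.card V ≤ 2 * G.degree v := by
    have := hdeg v
    rw [hN] at this
    have h2 : (Fintype.card V : ℝ) ≤ 2 * (G.degree v : ℝ) := by linarith
    exact_mod_cast h2
  have hdle : G.degree v ≤ Fintype.card V := hAd ▸ card_le_univ _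
  have hAne : A.Nonempty := by
    rw [← card_pos]
    have h := hdeg v
    rw [← hAd'] at h
    have : (0 : ℝ) < A.card := by linarith
    exact_mod_cast this
  have ht : ∀ w ∈ A, (G.degree v : ℝ) - N / 2 ≤ ((A ∩ G.neighborFinset w).card : ℝ) := by
    intro w _
    have h1 : (G.degree v : ℝ) + G.degree w ≤ N + (A ∩ G.neighborFinset w).card := by
      rw [hN]
      exact_mod_cast degree_add_degree_le G v w
    linarith [hdeg w]
  obtain ⟨k, hk⟩ : ∃ k, Fintype.card V / 2 = (Fintype.card V - G.degree v) + k :=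
    ⟨Fintype.card V / 2 - (Fintype.card V - G.degree v), by omega⟩
  have hkκ : (k : ℝ) ≤ G.degree v - N / 2 := by
    have h1 : 2 * k + Fintype.card V ≤ 2 * G.degree v := by omega
    have h2 : 2 * (k : ℝ) + N ≤ 2 * G.degree v := by
      rw [hN]
      exact_mod_cast h1
    linarith
  have hhalf : ∀ K ⊆ A, K.card = k → (∀ a ∈ K, ∀ b ∈ K, ¬ G.Adj a b) →
      N ^ 2 / 18 ≤ G.edgeFinset.card - ∑ w ∈ A, (G.degree w : ℝ)
        + (∑ w ∈ A, ((A ∩ G.neighborFinset w).card : ℝ)) / 2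
        + ∑ w ∈ K, ((G.degree w : ℝ) - (A ∩ G.neighborFinset w).card) := by
    intro K hKA hKk hK
    rw [← edgesIn_compl_union G A K hKA hK]
    apply hsparse
    rw [card_union_of_disjoint (disjoint_compl_left.mono_right hKA), card_compl, hAd, hKk, hk]
  have hexcess : ∀ w, 0 ≤ (G.degree w : ℝ) - (A ∩ G.neighborFinset w).card := by
    intro w
    rw [← SimpleGraph.card_neighborFinset_eq_degree, sub_nonneg]
    exact_mod_cast card_le_card inter_subset_right
  rw [← hAd']
  refine sum_codegree_lower_bound A (fun w => (G.degree w : ℝ))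
    (fun w => ((A ∩ G.neighborFinset w).card : ℝ)) (κ := G.degree v - N / 2) c hAne
    (by rw [hAd']; ring) (by linarith [hdeg v]) ht ?_ ?_
  · set e' : ℝ := G.edgeFinset.card - ∑ w ∈ A, (G.degree w : ℝ)
        + (∑ w ∈ A, ((A ∩ G.neighborFinset w).card : ℝ)) / 2 with he'
    have hu : ∀ u ∈ A, ((A ∩ G.neighborFinset u).card : ℝ) * (N ^ 2 / 18 - e')
        ≤ (G.degree v - N / 2) * ∑ w ∈ A, adjIndicator G u w
          * ((G.degree w : ℝ) - (A ∩ G.neighborFinset w).card) := by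
      intro u hu
      have hvu : G.Adj v u := by simpa [hA] using hu
      obtain ⟨K, hKI, hKk, hK⟩ := exists_subset_card_eq_sum_le
        (fun w => (G.degree w : ℝ) - (A ∩ G.neighborFinset w).card) k
        (A ∩ G.neighborFinset u) (by exact_mod_cast hkκ.trans (ht u hu))
      have hadj : ∀ a ∈ K, G.Adj v a ∧ G.Adj u a := fun a ha => by
        simpa [hA] using hKI ha
      have h1 := hhalf K (hKI.trans inter_subset_left) hKk fun a ha b hb =>
        not_adj_of_mem_common_neighbors G hK4 hvu (hadj a ha).1 (hadj a ha).2
          (hadj b hb).1 (hadj b hb).2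
      have h2 : ∑ w ∈ A ∩ G.neighborFinset u,
          ((G.degree w : ℝ) - (A ∩ G.neighborFinset w).card)
          = ∑ w ∈ A, adjIndicator G u w
            * ((G.degree w : ℝ) - (A ∩ G.neighborFinset w).card) := by
        rw [← filter_mem_eq_inter, sum_filter]
        exact sum_congr rfl fun w _ => by simp [adjIndicator]
      have h3 := sum_nonneg fun w (_ : w ∈ A ∩ G.neighborFinset u) => hexcess w
      rw [← h2]
      refine le_trans (le_trans (mul_le_mul_of_nonneg_left ?_ (Nat.cast_nonneg _)) hK)
        (mul_le_mul_of_nonneg_right hkκ h3)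
      linarith
    have h := sum_le_sum hu
    rw [← sum_mul, ← mul_sum, sum_comm] at h
    refine h.trans (le_of_eq ?_)
    congr 1
    refine sum_congr rfl fun w _ => ?_
    rw [← sum_mul, card_inter_neighborFinset]
    congr 1
    exact sum_congr rfl fun x _ => by simp [adjIndicator, G.adj_comm]
  · intro h0
    have hκ0 : (A.card : ℝ) * (G.degree v - N / 2) ≤ 0 := by
      have := card_nsmul_le_sum A _ _ ht
      rwa [nsmul_eq_mul, h0] at this
    have hA0 : (0 : ℝ) < A.card := Nat.cast_pos.2 hAne.card_pos
    have hκ1 : (G.degree v : ℝ) - N / 2 ≤ 0 := nonpos_of_mul_nonpos_right hκ0 hA0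
    have hk0 : k = 0 := by
      have : (k : ℝ) ≤ 0 := hkκ.trans hκ1
      exact_mod_cast le_antisymm this (Nat.cast_nonneg k)
    have := hhalf ∅ (empty_subset _) (by simp [hk0]) (by simp)
    rw [h0] at this
    simpa using this

lemma codegree_eq_sum (u v : V) : ((G.neighborFinset u ∩ G.neighborFinset v).card : ℝ)
    = ∑ w, adjIndicator G u w * adjIndicator G v w := by
  rw [card_inter_neighborFinset, sum_neighborFinset_eq]

/-- A lower bound for the average codegree of an edge. -/
lemma average_codegree_ge (hK4 : G.CliqueFree 4) (N c : ℝ) (hN : N = Fintype.card V) (hN0 : 0 < N)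
    (he : (G.edgeFinset.card : ℝ) = c * N ^ 2)
    (hdeg : ∀ v, N / 2 ≤ (G.degree v : ℝ) ∧ (G.degree v : ℝ) ≤ 9 * N / 14)
    (hsparse : ∀ S : Finset V, S.card = Fintype.card V / 2 → N ^ 2 / 18 ≤ (edgesIn G S : ℝ)) :
    (∑ u, ∑ v, adjIndicator G u v) * (N / (9 * (1 - 2 * c)))
      ≤ ∑ u, ∑ v, adjIndicator G u v
        * ((G.neighborFinset u ∩ G.neighborFinset v).card : ℝ) := by
  set s := 1 - 2 * c with hs
  set r : V → ℝ := fun v => 1 - (G.degree v : ℝ) / N with hr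
  have hr₀ : ∀ v, 5 / 14 ≤ r v := fun v => by
    have : (G.degree v : ℝ) / N ≤ 9 / 14 := by
      rw [div_le_iff₀ hN0]
      linarith [(hdeg v).2]
    simp only [hr]
    linarith
  have hr₁ : ∀ v, r v ≤ 1 / 2 := fun v => by
    have : 1 / 2 ≤ (G.degree v : ℝ) / N := by
      rw [le_div_iff₀ hN0]
      linarith [(hdeg v).1]
    simp only [hr]
    linarith
  have hd : ∀ v, (G.degree v : ℝ) = N * (1 - r v) := fun v => by
    simp only [hr]
    field_simp
    ring
  have hdsum : ∑ v, (G.degree v : ℝ) = 2 * (c * N ^ 2) := by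
    rw [← he]
    exact_mod_cast G.sum_degrees_eq_twice_card_edges
  have hrsum : ∑ v, (s - r v) = 0 := by
    have : ∑ v, (G.degree v : ℝ) / N = 2 * c * N := by
      rw [← sum_div, hdsum]
      field_simp
    simp only [hr, sum_sub_distrib, this, sum_const, nsmul_eq_mul, card_univ, ← hN, hs]
    ring
  have hmean : N * s = ∑ v, r v := by
    rw [sum_sub_distrib, sum_const, nsmul_eq_mul, card_univ, ← hN] at hrsum
    linarith
  have hs₀ : 5 / 14 ≤ s := by
    have := card_nsmul_le_sum univ r _ fun v _ => hr₀ v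
    rw [nsmul_eq_mul, card_univ, ← hN, ← hmean] at this
    exact le_of_mul_le_mul_left this hN0
  have hs₁ : s ≤ 1 / 2 := by
    have := sum_le_card_nsmul univ r _ fun v _ => hr₁ v
    rw [nsmul_eq_mul, card_univ, ← hN, ← hmean] at this
    exact le_of_mul_le_mul_left this hN0
  set φ : V → V → ℝ := fun v w =>
    (1 / 9 + (s - r w) - ((s - r v) + (s - r w)) ^ 2 / 2) / r v with hφ
  set L : ℝ := 1 / (9 * s ^ 2) + 1 / s with hL
  set h : V → ℝ := fun v => L * ((s - r v) ^ 2 / (1 - r v) - (s - r v)) with hh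
  have hvertex : ∀ v, N * ∑ w, adjIndicator G v w * φ v w
      ≤ ∑ w, adjIndicator G v w * ((G.neighborFinset v ∩ G.neighborFinset w).card : ℝ) := by
    intro v
    have h1 := sum_codegree_ge G hK4 N hN hN0 (fun v => (hdeg v).1) hsparse v
      (4 * c * N - G.degree v)
    have hrv : 0 < r v := by linarith [hr₀ v]
    rw [sum_neighborFinset_eq, sum_neighborFinset_eq, he] at h1
    have h2 : ∀ w, adjIndicator G v w * (N ^ 2 / 9 - 2 * (c * N ^ 2) + N * (G.degree w : ℝ)
          - ((G.degree w : ℝ) - (4 * c * N - G.degree v)) ^ 2 / 2)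
        = (N * (adjIndicator G v w * φ v w)) * (N * r v) := fun w => by
      simp only [hφ, hd]
      field_simp
      rw [hs]
      ring
    rw [sum_congr rfl fun w _ => h2 w, ← sum_mul, ← mul_sum,
      show N - (G.degree v : ℝ) = N * r v by rw [hd]; ring] at h1
    exact le_of_mul_le_mul_right h1 (mul_pos hN0 hrv)
  have hsum := sum_le_sum fun v (_ : v ∈ univ) => hvertex v
  rw [← mul_sum] at hsum
  have hswap : ∀ f : V → V → ℝ, ∑ v, ∑ w, adjIndicator G v w * f w v
      = ∑ v, ∑ w, adjIndicator G v w * f v w := fun f => by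
    rw [sum_comm]
    exact sum_congr rfl fun u _ => sum_congr rfl fun v _ => by rw [adjIndicator_comm]
  have hedge : ∑ v, ∑ w, adjIndicator G v w * (2 / (9 * s))
      ≤ ∑ v, ∑ w, adjIndicator G v w * (φ v w + φ w v + h v + h w) :=
    sum_le_sum fun v _ => sum_le_sum fun w _ => mul_le_mul_of_nonneg_left
      (edge_inequality (hr₀ v) (hr₁ v) (hr₀ w) (hr₁ w) hs₀ hs₁) (adjIndicator_nonneg G v w)
  have hh0 : ∑ v, ∑ w, adjIndicator G v w * h v = 0 := by
    have h1 : ∀ v, ∑ w, adjIndicator G v w * h v = (L * N * (s - 1)) * (s - r v) := fun v => by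
      have h0 : 1 - r v ≠ 0 := by linarith [hr₁ v]
      rw [← sum_mul, ← degree_eq_sum_adjIndicator, hd]
      simp only [hh]
      field_simp
      ring
    rw [sum_congr rfl fun v _ => h1 v, ← mul_sum, hrsum, mul_zero]
  simp only [mul_add, sum_add_distrib] at hedge
  rw [hswap φ, hswap fun v _ => h v, hh0] at hedge
  simp only [← sum_mul] at hedge
  have h3 : (∑ u, ∑ v, adjIndicator G u v) * (N / (9 * s))
      = N * ((∑ u, ∑ v, adjIndicator G u v) * (2 / (9 * s))) / 2 := by ring
  rw [h3]
  have h4 := mul_le_mul_of_nonneg_left hedge hN0.le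
  linarith

end Graph

/-- A `K₄`-free graph on `n` vertices with `cn²` edges (`c < 1/2`), all degrees
between `n/2` and `9n/14`, in which every vertex set of size `⌊n/2⌋` spans at least `n²/18`
edges, contains three pairwise disjoint independent sets of total size at least
`n/(3(1 − 2c))`. -/
theorem three_large_independent_sets {n : ℕ} {c : ℝ} (hc : c < 1 / 2)
    (G : SimpleGraph (Fin n)) [DecidableRel G.Adj]
    (hK4 : G.CliqueFree 4) (he : (G.edgeFinset.card : ℝ) = c * (n : ℝ) ^ 2)
    (hdeg : ∀ v, (n : ℝ) / 2 ≤ (G.degree v : ℝ) ∧ (G.degree v : ℝ) ≤ 9 * (n : ℝ) / 14)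
    (hsparse : ∀ S : Finset (Fin n), S.card = n / 2 →
      (n : ℝ) ^ 2 / 18 ≤ (edgesIn G S : ℝ)) :
    ∃ V₁ V₂ V₃ : Finset (Fin n),
      Disjoint V₁ V₂ ∧ Disjoint V₁ V₃ ∧ Disjoint V₂ V₃ ∧
      (∀ u ∈ V₁, ∀ v ∈ V₁, ¬ G.Adj u v) ∧
      (∀ u ∈ V₂, ∀ v ∈ V₂, ¬ G.Adj u v) ∧
      (∀ u ∈ V₃, ∀ v ∈ V₃, ¬ G.Adj u v) ∧
      (n : ℝ) / (3 * (1 - 2 * c)) ≤ (V₁.card : ℝ) + (V₂.card : ℝ) + (V₃.card : ℝ) := by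

  rcases Nat.eq_zero_or_pos n with rfl | hn
  · exact ⟨∅, ∅, ∅, by simp⟩
  have hN0 : (0 : ℝ) < n := by exact_mod_cast hn
  have hs : 0 < 1 - 2 * c := by linarith
  set t : Fin n → Fin n → ℝ :=
    fun u v => ((G.neighborFinset u ∩ G.neighborFinset v).card : ℝ) with ht
  set μ : ℝ := n / (9 * (1 - 2 * c)) with hμ
  have hμ0 : 0 < μ := by positivity
  set P := ∑ u, ∑ v, adjIndicator G u v with hP
  set T₁ := ∑ u, ∑ v, adjIndicator G u v * t u v with hT₁
  set T₂ := ∑ u, ∑ v, adjIndicator G u v * t u v ^ 2 with hT₂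
  have hP0 : 0 < P := by
    have : Nonempty (Fin n) := ⟨⟨0, hn⟩⟩
    refine sum_pos (fun u _ => ?_) univ_nonempty
    rw [← degree_eq_sum_adjIndicator]
    linarith [(hdeg u).1]
  have hlow : P * μ ≤ T₁ := average_codegree_ge G hK4 n c (by simp) hN0 he hdeg
    (by simpa using hsparse)
  have hT₁0 : 0 < T₁ := lt_of_lt_of_le (by positivity) hlow
  have hvar : 0 ≤ T₂ - 2 * μ * T₁ + μ ^ 2 * P := by
    have h1 : 0 ≤ ∑ u, ∑ v, adjIndicator G u v * (t u v - μ) ^ 2 :=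
      sum_nonneg fun u _ => sum_nonneg fun v _ =>
        mul_nonneg (adjIndicator_nonneg G u v) (sq_nonneg _)
    have h2 : ∀ u v, adjIndicator G u v * (t u v - μ) ^ 2
        = adjIndicator G u v * t u v ^ 2 - 2 * μ * (adjIndicator G u v * t u v)
          + μ ^ 2 * adjIndicator G u v := fun u v => by ring
    simpa only [h2, sum_add_distrib, sum_sub_distrib, ← mul_sum] using h1
  obtain ⟨u, v, w, huv, huw, hvw, htri⟩ :=
    exists_triangle_sum_codegree_ge G t (fun u v => codegree_eq_sum G u v) hT₁0
  have hT₂ : μ * T₁ ≤ T₂ := by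
    have := mul_le_mul_of_nonneg_left hlow hμ0.le
    linarith
  have hbig : 3 * μ ≤ t u v + t u w + t v w := by
    refine le_of_mul_le_mul_left ?_ hT₁0
    linarith
  have hdisj : ∀ x, G.Adj u x → G.Adj v x → G.Adj w x → False := fun x hu hv hw =>
    not_adj_of_mem_common_neighbors G hK4 huv huw hvw hu hv hw
  refine ⟨G.neighborFinset u ∩ G.neighborFinset v, G.neighborFinset u ∩ G.neighborFinset w,
    G.neighborFinset v ∩ G.neighborFinset w, ?_, ?_, ?_, ?_, ?_, ?_, ?_⟩
  · rw [disjoint_left]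
    intro x h₁ h₂
    simp only [mem_inter, SimpleGraph.mem_neighborFinset] at h₁ h₂
    exact hdisj x h₁.1 h₁.2 h₂.2
  · rw [disjoint_left]
    intro x h₁ h₂
    simp only [mem_inter, SimpleGraph.mem_neighborFinset] at h₁ h₂
    exact hdisj x h₁.1 h₁.2 h₂.2
  · rw [disjoint_left]
    intro x h₁ h₂
    simp only [mem_inter, SimpleGraph.mem_neighborFinset] at h₁ h₂
    exact hdisj x h₁.1 h₂.1 h₁.2
  · intro a ha b hb
    simp only [mem_inter, SimpleGraph.mem_neighborFinset] at ha hb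
    exact not_adj_of_mem_common_neighbors G hK4 huv ha.1 ha.2 hb.1 hb.2
  · intro a ha b hb
    simp only [mem_inter, SimpleGraph.mem_neighborFinset] at ha hb
    exact not_adj_of_mem_common_neighbors G hK4 huw ha.1 ha.2 hb.1 hb.2
  · intro a ha b hb
    simp only [mem_inter, SimpleGraph.mem_neighborFinset] at ha hb
    exact not_adj_of_mem_common_neighbors G hK4 hvw ha.1 ha.2 hb.1 hb.2
  · calc (n : ℝ) / (3 * (1 - 2 * c)) = 3 * μ := by
          rw [hμ]
          field_simp
          norm_num
      _ ≤ _ := hbig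
end

section
/- Let 1/2 < α ≤ 1 and n ∈ ℕ with αn ∈ ℕ. Let G be a triangle-free graph on αn vertices with at least ((2α − 1)/4)·n² edges. Then G contains a matching with at least (2α − 1)·n/2 edges. -/
open Finset

/-- The pairs `(a i, b i)` are pairwise disjoint edges of `G`. -/
def IsMatchingFamily {V : Type*} (G : SimpleGraph V) {ι : Type*} (a b : ι → V) : Prop :=
  Function.Injective (Sum.elim a b) ∧ ∀ i, G.Adj (a i) (b i)

namespace IsMatchingFamily

variable {V : Type*} {G : SimpleGraph V}

theorem exists_subgraph {m : ℕ} {a b : Fin m → V} (h : IsMatchingFamily G a b) :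
    ∃ M : G.Subgraph, M.IsMatching ∧ M.edgeSet.ncard = m := by
  have ⟨haa, hbb, hab⟩ := Sum.elim_injective.1 h.1
  have hadj := h.2
  refine ⟨⨆ i, G.subgraphOfAdj (hadj i),
    SimpleGraph.Subgraph.IsMatching.iSup
      (fun i => SimpleGraph.Subgraph.IsMatching.subgraphOfAdj (hadj i)) ?_, ?_⟩
  · intro i j hij
    simp only [SimpleGraph.support_subgraphOfAdj]
    rw [Set.disjoint_left]
    grind
  · have hedge : (⨆ i, G.subgraphOfAdj (hadj i)).edgeSet =
        Set.range fun i => s(a i, b i) := by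
      ext e
      simp [SimpleGraph.Subgraph.edgeSet_iSup, eq_comm]
    rw [hedge, Set.ncard_range_of_injective, Nat.card_fin]
    intro i j hij
    simp only [Sym2.eq_iff] at hij
    grind

theorem option {ι : Type*} {a b : ι → V} (h : IsMatchingFamily G a b) {u v : V}
    (huv : G.Adj u v) (hu : u ∉ Set.range (Sum.elim a b)) (hv : v ∉ Set.range (Sum.elim a b)) :
    IsMatchingFamily G (fun o : Option ι => o.elim u a) (fun o => o.elim v b) := by
  have hne := huv.ne
  have ⟨haa, hbb, hab⟩ := Sum.elim_injective.1 h.1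
  simp only [Set.mem_range, Sum.exists, Sum.elim_inl, Sum.elim_inr, not_or, not_exists] at hu hv
  refine ⟨?_, ?_⟩
  · rintro ((_ | i) | (_ | i)) ((_ | j) | (_ | j)) hij <;>
      simp only [Sum.elim_inl, Sum.elim_inr, Option.elim_none, Option.elim_some] at hij <;>
      grind
  · rintro (_ | i)
    exacts [huv, h.2 i]

theorem comp_equiv {ι κ : Type*} {a b : ι → V} (h : IsMatchingFamily G a b) (e : κ ≃ ι) :
    IsMatchingFamily G (a ∘ e) (b ∘ e) := by
  refine ⟨?_, fun i => h.2 (e i)⟩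
  rw [← Sum.elim_comp_map]
  exact h.1.comp (Sum.map_injective.2 ⟨e.injective, e.injective⟩)

theorem two_mul_le_card [Fintype V] {m : ℕ} {a b : Fin m → V} (h : IsMatchingFamily G a b) :
    2 * m ≤ Fintype.card V := by
  simpa [two_mul] using Fintype.card_le_of_injective _ h.1

end IsMatchingFamily

/-- Some family of disjoint edges meets every edge of a finite graph. -/
theorem exists_isMatchingFamily_meeting_every_edge {V : Type*} [Fintype V] (G : SimpleGraph V) :
    ∃ (m : ℕ) (a b : Fin m → V), IsMatchingFamily G a b ∧
      ∀ u v, G.Adj u v → u ∈ Set.range (Sum.elim a b) ∨ v ∈ Set.range (Sum.elim a b) := by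
  classical
  let P : ℕ → Prop := fun m => ∃ a b : Fin m → V, IsMatchingFamily G a b
  have hP0 : P 0 := ⟨Fin.elim0, Fin.elim0, Function.injective_of_subsingleton _, fun i => i.elim0⟩
  obtain ⟨a, b, hab⟩ := Nat.findGreatest_spec (Nat.zero_le (Fintype.card V)) hP0
  refine ⟨_, a, b, hab, fun u v huv => ?_⟩
  by_contra! hcon
  have hnext := (hab.option huv hcon.1 hcon.2).comp_equiv (finSuccEquiv _)
  have hle := Nat.le_findGreatest (P := P) (n := Fintype.card V)
    (by have := hnext.two_mul_le_card; omega) ⟨_, _, hnext⟩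
  omega

theorem not_adj_of_cliqueFree_three {V : Type*} {G : SimpleGraph V} (h3 : G.CliqueFree 3)
    {x y z : V} (hxy : G.Adj x y) (hxz : G.Adj x z) : ¬ G.Adj y z := by
  classical
  exact fun hyz => h3 {x, y, z} (SimpleGraph.is3Clique_triple_iff.2 ⟨hxy, hxz, hyz⟩)

theorem degree_add_degree_le_card {V : Type*} [Fintype V] {G : SimpleGraph V} [DecidableRel G.Adj]
    (h3 : G.CliqueFree 3) {x y : V} (hxy : G.Adj x y) :
    G.degree x + G.degree y ≤ Fintype.card V := by
  classical
  rw [← G.card_neighborFinset_eq_degree, ← G.card_neighborFinset_eq_degree,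
    ← card_union_of_disjoint]
  · exact card_le_univ _
  · rw [Finset.disjoint_left]
    intro z hx hy
    rw [SimpleGraph.mem_neighborFinset] at hx hy
    exact not_adj_of_cliqueFree_three h3 hxy hx hy

/-- In a triangle-free graph, a family of `m` disjoint edges meeting every edge bounds the
number of edges by `m * (|V| - m)`. -/
theorem card_edgeFinset_le_of_isMatchingFamily {V : Type*} [Fintype V] {G : SimpleGraph V}
    [DecidableRel G.Adj] (h3 : G.CliqueFree 3) {m : ℕ} {a b : Fin m → V}
    (h : IsMatchingFamily G a b)
    (hmax : ∀ u v, G.Adj u v → u ∈ Set.range (Sum.elim a b) ∨ v ∈ Set.range (Sum.elim a b)) :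
    #G.edgeFinset ≤ m * (Fintype.card V - m) := by
  classical
  set W : Finset V := univ.image (Sum.elim a b) with hW
  have hWcard : #W = 2 * m := by
    rw [hW, card_image_of_injective _ h.1]
    simp [two_mul]
  have hcovered : ∑ v ∈ W, G.degree v ≤ m * Fintype.card V := by
    rw [hW, sum_image h.1.injOn, Fintype.sum_sum_type, ← sum_add_distrib]
    exact (sum_le_card_nsmul univ _ _
      fun i _ => degree_add_degree_le_card h3 (h.2 i)).trans_eq (by simp)
  have huncovered : ∀ u ∈ Wᶜ, G.degree u ≤ m := by
    intro u hu
    have hu' : u ∉ Set.range (Sum.elim a b) := by simpa [hW] using hu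
    have hsub : G.neighborFinset u ⊆
        univ.image fun i => if G.Adj u (a i) then a i else b i := by
      intro v hv
      rw [SimpleGraph.mem_neighborFinset] at hv
      obtain ⟨i | i, rfl⟩ := (hmax u v hv).resolve_left hu'
      · exact mem_image.2 ⟨i, mem_univ _, if_pos hv⟩
      · exact mem_image.2 ⟨i, mem_univ _,
          if_neg fun hua => not_adj_of_cliqueFree_three h3 hua hv (h.2 i)⟩
    calc G.degree u ≤ _ := card_le_card hsub
      _ ≤ m := by simpa using card_image_le (s := (univ : Finset (Fin m)))
  have hrest := sum_le_card_nsmul Wᶜ _ m huncovered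
  have hsum := G.sum_degrees_eq_twice_card_edges
  rw [← sum_add_sum_compl W] at hsum
  rw [card_compl, hWcard, smul_eq_mul] at hrest
  have hcard := h.two_mul_le_card
  obtain ⟨d, hd⟩ := Nat.exists_eq_add_of_le hcard
  rw [hd] at hcovered hrest ⊢
  rw [show 2 * m + d - m = m + d by omega]
  rw [show 2 * m + d - 2 * m = d by omega] at hrest
  nlinarith

/-- For `1/2 < α ≤ 1` with `αn ∈ ℕ`, every triangle-free graph on `αn` vertices
with at least `((2α−1)/4)n²` edges contains a matching with at least `(2α−1)n/2` edges. -/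
theorem triangle_free_large_matching {α : ℝ} (hα1 : 1 / 2 < α) (hα2 : α ≤ 1) {n k : ℕ}
    (hk : (k : ℝ) = α * (n : ℝ)) (G : SimpleGraph (Fin k)) [DecidableRel G.Adj]
    (h3 : G.CliqueFree 3)
    (he : (2 * α - 1) / 4 * (n : ℝ) ^ 2 ≤ (G.edgeFinset.card : ℝ)) :
    ∃ M : G.Subgraph, M.IsMatching ∧
      (2 * α - 1) * (n : ℝ) / 2 ≤ (M.edgeSet.ncard : ℝ) := by
  obtain ⟨m, a, b, hab, hmax⟩ := exists_isMatchingFamily_meeting_every_edge G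
  obtain ⟨M, hM, hMcard⟩ := hab.exists_subgraph
  refine ⟨M, hM, ?_⟩
  rw [hMcard]
  have hm := hab.two_mul_le_card
  have hedges := card_edgeFinset_le_of_isMatchingFamily h3 hab hmax
  rw [Fintype.card_fin] at hm hedges
  have hedges' : (#G.edgeFinset : ℝ) ≤ m * (k - m) := by
    rw [← Nat.cast_sub (by omega)]
    exact_mod_cast hedges
  have hkn : (k : ℝ) ≤ n := by
    rw [hk]
    exact mul_le_of_le_one_left n.cast_nonneg hα2
  have ht : (2 * α - 1) * n = 2 * k - n := by rw [hk]; ring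
  have he' : (2 * α - 1) / 4 * (n : ℝ) ^ 2 = (2 * k - n) * n / 4 := by rw [hk]; ring
  rw [he'] at he
  rw [ht]
  by_contra! hlt
  have hpos : 0 < (2 * (k : ℝ) - n - 2 * m) * (n - 2 * m) :=
    mul_pos (by linarith) (by linarith)
  nlinarith
end
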